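/- arXiv:0709.2593 — 4 statements merged into one kernel-verified Lean document; each statement's English description precedes it below -/
import Mathlib

section
/- For every integer n ≥ 4, ∑_{k=2}^{n-2} B_k B_{n-k}/(k(n-k)) = ∑_{k=2}^{n-2} C(n,k) B_k B_{n-k}/(k(n-k)) + 2 H_n B_n / n, where H_n = ∑_{i=1}^n 1/i. -/
open Polynomial in
/-- The scaled Bernoulli polynomials. -/
noncomputable def mkb (k : ℕ) : ℚ[X] := C ((k : ℚ)⁻¹) * Polynomial.bernoulli k

/-- Scaled Bernoulli numbers with the first two terms removed. -/
def mka (k : ℕ) : ℚ := if 2 ≤ k then _root_.bernoulli k / k else 0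

/-- Harmonic sums. -/
def mkH (n : ℕ) : ℚ := ∑ i ∈ Finset.range n, (1 : ℚ) / (i + 1)

open Polynomial in
/-- Left-hand polynomial. -/
noncomputable def mkP (n : ℕ) : ℚ[X] := ∑ p ∈ Finset.HasAntidiagonal.antidiagonal n, mkb p.1 * mkb p.2

open Polynomial in
/-- Appell sum. -/
noncomputable def mkS (n : ℕ) : ℚ[X] :=
  ∑ p ∈ Finset.HasAntidiagonal.antidiagonal n, C ((n.choose p.2 : ℚ) * mka p.1) * Polynomial.bernoulli p.2

open Polynomial in
/-- Right-hand polynomial. -/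
noncomputable def mkR (n : ℕ) : ℚ[X] := C (2 / (n : ℚ)) * mkS n + C (2 * mkH (n - 1)) * mkb n

open Polynomial in
lemma mkb_zero : mkb 0 = 0 := by simp [mkb]

open Polynomial in
lemma mkb_deriv (k : ℕ) : derivative (mkb (k + 1)) = C (k : ℚ) * mkb k + if k = 0 then 1 else 0 := by
  have h1 : ((k : ℚ) + 1) ≠ 0 := by positivity
  have e : derivative (mkb (k + 1)) = Polynomial.bernoulli k := by
    rw [mkb, derivative_C_mul, derivative_bernoulli_add_one, ← mul_assoc,
      show ((k : ℚ[X]) + 1) = C ((k : ℚ) + 1) by simp, ← C_mul]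
    push_cast
    rw [inv_mul_cancel₀ h1]; simp
  rw [e]
  rcases Nat.eq_zero_or_pos k with rfl | hk
  · simp
  · have : (k : ℚ) ≠ 0 := by positivity
    rw [mkb, ← mul_assoc, ← C_mul, mul_inv_cancel₀ this]
    simp [hk.ne']

open Polynomial in
lemma mkP_deriv (n : ℕ) : derivative (mkP (n + 1)) = C (n : ℚ) * mkP n + 2 * mkb n := by
  have sw : ∀ (m : ℕ) (f g : ℕ → ℚ[X]), ∑ p ∈ Finset.HasAntidiagonal.antidiagonal m, f p.1 * g p.2
      = ∑ p ∈ Finset.HasAntidiagonal.antidiagonal m, g p.1 * f p.2 := by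
    intro m f g
    rw [← Finset.Nat.sum_antidiagonal_swap]
    exact Finset.sum_congr rfl fun p _ => by simp [mul_comm]
  have e1 : derivative (mkP (n + 1)) =
      2 * ∑ p ∈ Finset.HasAntidiagonal.antidiagonal (n + 1), derivative (mkb p.1) * mkb p.2 := by
    rw [mkP, derivative_sum]
    simp only [derivative_mul, Finset.sum_add_distrib]
    rw [sw (n + 1) mkb (fun k => derivative (mkb k))]
    ring
  have e2 : C (n : ℚ) * mkP n = 2 * ∑ p ∈ Finset.HasAntidiagonal.antidiagonal n, (C (p.1 : ℚ) * mkb p.1) * mkb p.2 := by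
    rw [two_mul]
    nth_rewrite 2 [sw n (fun k => C (k : ℚ) * mkb k) mkb]
    rw [← Finset.sum_add_distrib, mkP, Finset.mul_sum]
    refine Finset.sum_congr rfl fun p hp => ?_
    rw [← Finset.HasAntidiagonal.mem_antidiagonal.mp hp]
    push_cast
    rw [C_add]; ring
  rw [e1, e2, Finset.Nat.sum_antidiagonal_succ]
  simp only [mkb_deriv, mkb_zero, derivative_zero, zero_mul, zero_add, add_mul,
    Finset.sum_add_distrib, mul_add]
  congr 2
  rw [Finset.sum_eq_single (0, n)]
  · simp
  · rintro ⟨i, j⟩ h1 h2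
    have : i ≠ 0 := by
      rintro rfl
      simp at h1
      simp [h1] at h2
    simp [this]
  · simp

open Polynomial in
lemma mkS_deriv (n : ℕ) : derivative (mkS (n + 1)) = C ((n : ℚ) + 1) * mkS n := by
  rw [mkS, derivative_sum, Finset.Nat.sum_antidiagonal_succ', mkS, Finset.mul_sum]
  simp only [derivative_mul, derivative_C, zero_mul, zero_add, derivative_bernoulli_add_one,
    Polynomial.bernoulli_zero, derivative_one, mul_zero, add_zero]
  refine Finset.sum_congr rfl fun p hp => ?_
  have h := Nat.add_one_mul_choose_eq n p.2
  have h' : ((n : ℚ) + 1) * (n.choose p.2) = ((n+1).choose (p.2+1)) * (p.2 + 1) := by exact_mod_cast h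
  rw [show ((p.2 : ℚ[X]) + 1) = C ((p.2 : ℚ) + 1) by simp, ← mul_assoc, ← mul_assoc, ← C_mul,
    ← C_mul, ← mul_assoc, h']
  congr 2; ring

open Polynomial in
lemma mkR_deriv (n : ℕ) : derivative (mkR (n + 1)) = C (n : ℚ) * mkR n + 2 * mkb n := by
  have h1 : ((n : ℚ) + 1) ≠ 0 := by positivity
  rw [mkR, derivative_add, derivative_C_mul, derivative_C_mul, mkS_deriv, mkb_deriv, ← mul_assoc,
    ← C_mul]
  push_cast
  rw [div_mul_cancel₀ _ h1]
  rcases n with _ | n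
  · simp [mkb_zero, mkH, mkS, mka]
  · have h2 : ((n : ℚ) + 1) ≠ 0 := by positivity
    have h3 : mkH (n + 1) = mkH n + 1 / (n + 1) := by simp [mkH, Finset.sum_range_succ]
    simp only [mkR, Nat.add_sub_cancel, h3, mul_add, ← mul_assoc, ← C_mul]
    push_cast
    rw [mul_div_cancel₀ _ h2]
    simp only [Nat.succ_ne_zero, if_false, add_zero, add_assoc]
    congr 1
    rw [show (2 : ℚ[X]) = C 2 from (map_ofNat C 2).symm, mul_zero, add_zero, ← add_mul, ← C_add]
    congr 2
    field_simp

lemma mk_b' (k : ℕ) : bernoulli' k = _root_.bernoulli k + if k = 1 then 1 else 0 := by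
  by_cases h : k = 1
  · subst h; norm_num
  · simp [h, bernoulli_eq_bernoulli'_of_ne_one h]

open Polynomial in
lemma mkb_eval (k : ℕ) : (mkb k).eval 1 = (mkb k).eval 0 + if k = 1 then 1 else 0 := by
  simp only [mkb, eval_mul, eval_C, Polynomial.bernoulli_eval_one, Polynomial.bernoulli_eval_zero,
    mk_b']
  by_cases h : k = 1
  · subst h; norm_num
  · simp [h]

lemma mk_delta (n : ℕ) (f : ℕ → ℚ) :
    ∑ p ∈ Finset.HasAntidiagonal.antidiagonal (n + 2), f p.1 * (if p.2 = 1 then (1 : ℚ) else 0) = f (n + 1) := by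
  rw [Finset.sum_eq_single (n + 1, 1)]
  · simp
  · rintro ⟨i, j⟩ h1 h2
    have : j ≠ 1 := by
      rintro rfl
      simp at h1
      simp at h2
      omega
    simp [this]
  · simp

open Polynomial in
lemma mkP_eval (n : ℕ) : (mkP (n + 2)).eval 1 = (mkP (n + 2)).eval 0 + 2 * mka (n + 1) := by
  have hd := mk_delta n (fun k => (mkb k).eval 0)
  have hd1 := mk_delta n (fun k => if k = 1 then 1 else 0)
  have hd2 : ∑ p ∈ Finset.HasAntidiagonal.antidiagonal (n + 2), (if p.1 = 1 then (1 : ℚ) else 0) * (mkb p.2).eval 0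
      = (mkb (n + 1)).eval 0 := by
    rw [← hd, ← Finset.Nat.sum_antidiagonal_swap]
    exact Finset.sum_congr rfl fun p _ => by simp only [Prod.fst_swap, Prod.snd_swap]; ring
  simp only [mkP, eval_finsetSum, eval_mul, mkb_eval, add_mul, mul_add, Finset.sum_add_distrib]
  rw [hd, hd1, hd2]
  rcases n with _ | n
  · simp [mkb, mka]; norm_num
  · simp [mkb, mka]; ring

open Polynomial in
lemma mkR_eval (n : ℕ) : (mkR (n + 2)).eval 1 = (mkR (n + 2)).eval 0 + 2 * mka (n + 1) := by
  have hS : (mkS (n + 2)).eval 1 = (mkS (n + 2)).eval 0 + (n + 2) * mka (n + 1) := by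
    simp only [mkS, eval_finsetSum, eval_mul, eval_C, Polynomial.bernoulli_eval_one,
      Polynomial.bernoulli_eval_zero, mk_b', mul_add, Finset.sum_add_distrib]
    congr 1
    rw [← mk_delta n (fun k => ((n : ℚ) + 2) * mka k)]
    refine Finset.sum_congr rfl fun p _ => ?_
    by_cases h : p.2 = 1 <;> simp [h]
  have h2 : ((n : ℚ) + 2) ≠ 0 := by positivity
  simp only [mkR, eval_add, eval_mul, eval_C, hS, mkb_eval]
  push_cast
  simp
  field_simp
  ring

open Polynomial in
lemma mk_const (p : ℚ[X]) (h : derivative p = 0) : p = C (p.eval 0) := by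
  rw [← coeff_zero_eq_eval_zero]
  exact eq_C_of_derivative_eq_zero h

open Polynomial in
lemma mk_main (n : ℕ) : mkP (n + 1) = mkR (n + 1) := by
  set Q : ℕ → ℚ[X] := fun n => mkP n - mkR n with hQ
  have hd : ∀ n, derivative (Q (n + 1)) = C (n : ℚ) * Q n := by
    intro n
    simp only [hQ, derivative_sub, mkP_deriv, mkR_deriv]; ring
  have he : ∀ n, (Q (n + 2)).eval 1 = (Q (n + 2)).eval 0 := by
    intro n
    simp only [hQ, eval_sub, mkP_eval, mkR_eval]; ring
  have step : ∀ n, derivative (Q (n + 1)) = 0 → Q (n + 1) = 0 := by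
    intro n h
    have hc := mk_const _ h
    set d := (Q (n + 1)).eval 0
    have h3 := hd (n + 1)
    rw [hc] at h3
    have h4 : derivative (Q (n + 2) - C (((n + 1 : ℕ) : ℚ) * d) * X) = 0 := by
      rw [derivative_sub, h3]; simp
    have h5 := congrArg (eval 1) (mk_const _ h4)
    simp only [eval_sub, eval_mul, eval_C, eval_X, mul_one, mul_zero, sub_zero, he n] at h5
    have h6 : ((n + 1 : ℕ) : ℚ) * d = 0 := by linarith
    have h7 : d = 0 := by
      rcases mul_eq_zero.mp h6 with h | h
      · exact absurd h (by positivity)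
      · exact h
    rw [hc, h7, C_0]
  have all : ∀ n, Q (n + 1) = 0 := by
    intro n
    induction n with
    | zero => exact step 0 (by rw [hd]; simp)
    | succ n ih => exact step (n + 1) (by rw [hd, ih]; simp)
  exact sub_eq_zero.mp (all n)

/-- Miki's identity on Bernoulli numbers. -/
theorem miki_identity (n : ℕ) (hn : 4 ≤ n) :
    ∑ k ∈ Finset.Icc 2 (n - 2), bernoulli k * bernoulli (n - k) / ((k : ℚ) * (n - k)) =
      ∑ k ∈ Finset.Icc 2 (n - 2),
        (n.choose k : ℚ) * bernoulli k * bernoulli (n - k) / ((k : ℚ) * (n - k)) +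
      2 * (∑ i ∈ Finset.Icc 1 n, (1 : ℚ) / i) * bernoulli n / n := by
  obtain ⟨m, rfl⟩ : ∃ m, n = m + 4 := ⟨n - 4, by omega⟩
  have h := congrArg (Polynomial.eval 0) (mk_main (m + 3))
  have hH : ∑ i ∈ Finset.Icc 1 (m + 4), (1 : ℚ) / i = mkH (m + 3) + 1 / (m + 4) := by
    have : ∑ i ∈ Finset.Icc 1 (m + 4), (1 : ℚ) / i = mkH (m + 4) := by
      rw [mkH, Finset.range_eq_Ico, ← Finset.Ico_add_one_right_eq_Icc,
        Finset.sum_Ico_eq_sum_range, Finset.range_eq_Ico]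
      refine Finset.sum_congr rfl fun i _ => ?_
      push_cast; rw [add_comm]
    rw [this, mkH, Finset.sum_range_succ, ← mkH]
    push_cast; ring
  have hI : ∀ f : ℕ → ℚ, ∑ k ∈ Finset.Icc 2 (m + 4 - 2), f k
      = ∑ k ∈ Finset.range (m + 1), f (k + 2) := by
    intro f
    rw [show m + 4 - 2 = m + 2 by omega, ← Finset.Ico_add_one_right_eq_Icc,
      Finset.sum_Ico_eq_sum_range]
    refine Finset.sum_congr rfl fun i _ => by rw [add_comm]
  rw [hH, hI, hI]
  have hP : (mkP (m + 3 + 1)).eval 0 =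
      ∑ k ∈ Finset.range (m + 1), bernoulli (k + 2) * bernoulli (m + 4 - (k + 2)) /
        (((k + 2 : ℕ) : ℚ) * ((m + 4 : ℕ) - (k + 2 : ℕ)))
      + 2 * (bernoulli 1 * (bernoulli (m + 3) / (m + 3))) := by
    simp only [mkP, mkb, Polynomial.eval_finsetSum, Polynomial.eval_mul, Polynomial.eval_C,
      Polynomial.bernoulli_eval_zero]
    rw [Finset.Nat.sum_antidiagonal_eq_sum_range_succ_mk, Finset.sum_range_succ,
      Finset.sum_range_succ, Finset.sum_range_succ', Finset.sum_range_succ']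
    have : ∀ k ∈ Finset.range (m + 1), bernoulli (k + 2) * bernoulli (m + 4 - (k + 2)) /
        (((k + 2 : ℕ) : ℚ) * ((m + 4 : ℕ) - (k + 2 : ℕ))) =
        ((k + 1 + 1 : ℕ) : ℚ)⁻¹ * bernoulli (k + 1 + 1) *
        (((m + 3 + 1 - (k + 1 + 1) : ℕ) : ℚ)⁻¹ * bernoulli (m + 3 + 1 - (k + 1 + 1))) := by
      intro k hk
      have := Finset.mem_range.mp hk
      rw [Nat.cast_sub (by omega)]
      rw [div_eq_mul_inv, mul_inv]
      ring
    rw [Finset.sum_congr rfl this]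
    simp
    ring
  have hS : (mkS (m + 3 + 1)).eval 0 =
      ∑ k ∈ Finset.range (m + 1), ((m + 4).choose (k + 2) : ℚ) * (bernoulli (k + 2) / (k + 2 : ℕ))
        * bernoulli (m + 4 - (k + 2))
      + (m + 4) * (bernoulli 1 * (bernoulli (m + 3) / (m + 3))) + bernoulli (m + 4) / (m + 4) := by
    simp only [mkS, mka, Polynomial.eval_finsetSum, Polynomial.eval_mul, Polynomial.eval_C,
      Polynomial.bernoulli_eval_zero]
    rw [Finset.Nat.sum_antidiagonal_eq_sum_range_succ_mk, Finset.sum_range_succ,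
      Finset.sum_range_succ, Finset.sum_range_succ', Finset.sum_range_succ']
    have : ∀ k ∈ Finset.range (m + 1),
        ((m + 4).choose (k + 2) : ℚ) * (bernoulli (k + 2) / (k + 2 : ℕ))
        * bernoulli (m + 4 - (k + 2)) =
        ((m + 3 + 1).choose (m + 3 + 1 - (k + 1 + 1)) : ℚ) *
          (if 2 ≤ k + 1 + 1 then bernoulli (k + 1 + 1) / ((k + 1 + 1 : ℕ) : ℚ) else 0) *
          bernoulli (m + 3 + 1 - (k + 1 + 1)) := by
      intro k hk
      have := Finset.mem_range.mp hk
      rw [Nat.choose_symm (by omega), if_pos (by omega)]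
    rw [Finset.sum_congr rfl this]
    simp
    ring
  have hsym : 2 * ∑ k ∈ Finset.range (m + 1),
      ((m + 4).choose (k + 2) : ℚ) * (bernoulli (k + 2) / (k + 2 : ℕ))
        * bernoulli (m + 4 - (k + 2)) = (m + 4) * ∑ k ∈ Finset.range (m + 1),
        ((m + 4).choose (k + 2) : ℚ) * bernoulli (k + 2) * bernoulli (m + 4 - (k + 2)) /
          (((k + 2 : ℕ) : ℚ) * ((m + 4 : ℕ) - (k + 2 : ℕ))) := by
    rw [two_mul]
    nth_rewrite 2 [← Finset.sum_range_reflect]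
    rw [← Finset.sum_add_distrib, Finset.mul_sum]
    refine Finset.sum_congr rfl fun k hk => ?_
    obtain ⟨j, rfl⟩ : ∃ j, m = k + j := ⟨m - k, by have := Finset.mem_range.mp hk; omega⟩
    rw [show k + j + 1 - 1 - k = j by omega, show k + j + 4 - (j + 2) = k + 2 by omega,
      show k + j + 4 - (k + 2) = j + 2 by omega,
      show (k + j + 4).choose (j + 2) = (k + j + 4).choose (k + 2) from
        Nat.choose_symm_of_eq_add (by omega)]
    push_cast
    have h1 : (k : ℚ) + 2 ≠ 0 := by positivity
    have h2 : (j : ℚ) + 2 ≠ 0 := by positivity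
    rw [show (k : ℚ) + j + 4 - (k + 2) = j + 2 by ring]
    field_simp
    ring
  rw [hP, mkR, Polynomial.eval_add, Polynomial.eval_mul, Polynomial.eval_mul, Polynomial.eval_C,
    Polynomial.eval_C, hS, mkb, Polynomial.eval_mul, Polynomial.eval_C,
    Polynomial.bernoulli_eval_zero] at h
  have h4 : (m : ℚ) + 4 ≠ 0 := by positivity
  have h3 : (m : ℚ) + 3 ≠ 0 := by positivity
  have hc : ((m + 3 + 1 : ℕ) : ℚ) = m + 4 := by push_cast; ring
  rw [hc, show m + 3 + 1 - 1 = m + 3 by omega, show m + 3 + 1 = m + 4 by omega] at h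
  have hc' : ((m + 4 : ℕ) : ℚ) = m + 4 := by push_cast; ring
  rw [mul_add, mul_add, div_mul_eq_mul_div, hsym, mul_div_cancel_left₀ _ h4] at h
  have h5 : 2 / ((m : ℚ) + 4) * ((m + 4) * (bernoulli 1 * (bernoulli (m + 3) / (m + 3))))
      = 2 * (bernoulli 1 * (bernoulli (m + 3) / (m + 3))) := by
    field_simp
  rw [h5] at h
  have h6 : 2 * (mkH (m + 3) + 1 / ((m : ℚ) + 4)) * bernoulli (m + 4) / ((m + 4 : ℕ) : ℚ)
      = 2 / ((m : ℚ) + 4) * (bernoulli (m + 4) / (m + 4))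
        + 2 * mkH (m + 3) * (((m : ℚ) + 4)⁻¹ * bernoulli (m + 4)) := by
    rw [hc']; field_simp; ring
  rw [h6]
  rw [hc'] at h ⊢
  linarith
end

section
/- For every integer n ≥ 0 and x ≠ y: ∑_{k=0}^{n} B_k(x)B_{n-k}(y) − ∑_{k=0}^{n} C(n+1,k+1) [B_k(x−y)B_{n-k}(y) + B_k(y−x)B_{n-k}(x)]/(k+2) = (B_{n+1}(x)+B_{n+1}(y))/(x−y)² − (2/(n+2))·(B_{n+2}(x)−B_{n+2}(y))/(x−y)³. -/
/-- The `n`-th Bernoulli polynomial evaluated at a complex number. -/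
noncomputable def Bp (n : ℕ) (x : ℂ) : ℂ := Polynomial.aeval x (Polynomial.bernoulli n)

lemma Bp_shift (n : ℕ) (x : ℂ) : Bp n (x + 1) = Bp n x + n * x ^ (n - 1) := by
  have h := congrArg (Polynomial.aeval x) (Polynomial.bernoulli_comp_one_add_X n)
  simpa [Bp, Polynomial.aeval_comp, add_comm] using h

lemma Bp_hasDerivAt (n : ℕ) (x : ℂ) : HasDerivAt (Bp n) (n * Bp (n - 1) x) x := by
  have h := (Polynomial.bernoulli n).hasDerivAt_aeval x
  rw [Polynomial.derivative_bernoulli] at h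
  simp only [map_mul, map_natCast] at h
  exact h

lemma Bp_poly (n : ℕ) :
    ∀ x, Bp n x = ((Polynomial.bernoulli n).map (algebraMap ℚ ℂ)).eval x := by
  intro x
  simp [Bp, Polynomial.aeval_def, Polynomial.eval_map]

lemma Bp_gen (t : ℂ) :
    (PowerSeries.mk fun n => Bp n t / (n.factorial : ℂ)) * (PowerSeries.exp ℂ - 1) =
      PowerSeries.X * PowerSeries.rescale t (PowerSeries.exp ℂ) := by
  rw [← Polynomial.bernoulli_generating_function t]
  congr 2
  ext n
  simp [Bp, Algebra.smul_def, div_eq_inv_mul]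

lemma Bp_add (n : ℕ) (d y : ℂ) :
    Bp n (d + y) = ∑ j ∈ Finset.range (n + 1), (n.choose j : ℂ) * Bp j d * y ^ (n - j) := by
  have hne : (PowerSeries.exp ℂ - 1) ≠ 0 := by
    intro h
    have := congrArg (PowerSeries.coeff 1) h
    simp [PowerSeries.coeff_exp, PowerSeries.coeff_one] at this
  have key : (PowerSeries.mk fun n => Bp n (d + y) / (n.factorial : ℂ)) =
      (PowerSeries.mk fun n => Bp n d / (n.factorial : ℂ)) *
        PowerSeries.rescale y (PowerSeries.exp ℂ) := by
    apply mul_right_cancel₀ hne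
    rw [Bp_gen, mul_right_comm, Bp_gen, mul_assoc, PowerSeries.exp_mul_exp_eq_exp_add]
  have h := congrArg (PowerSeries.coeff n) key
  rw [PowerSeries.coeff_mul, Finset.Nat.sum_antidiagonal_eq_sum_range_succ_mk] at h
  simp only [PowerSeries.coeff_mk, PowerSeries.coeff_rescale, PowerSeries.coeff_exp] at h
  have hn : (n.factorial : ℂ) ≠ 0 := by exact_mod_cast n.factorial_ne_zero
  rw [div_eq_iff hn] at h
  rw [h, Finset.sum_mul]
  refine Finset.sum_congr rfl fun j hj => ?_
  have hj' : j ≤ n := Nat.lt_succ_iff.mp (Finset.mem_range.mp hj)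
  rw [Nat.cast_choose ℂ hj']
  have h1 : (j.factorial : ℂ) ≠ 0 := by exact_mod_cast j.factorial_ne_zero
  have h2 : ((n - j).factorial : ℂ) ≠ 0 := by exact_mod_cast (n - j).factorial_ne_zero
  simp
  field_simp

/-- multiplying a homogeneous sum by `y`. -/
lemma hom_mul (f : ℕ → ℂ) (y : ℂ) (n : ℕ) :
    y * ∑ j ∈ Finset.range (n + 1), f j * y ^ (n - j) =
      ∑ j ∈ Finset.range (n + 1), f j * y ^ (n + 1 - j) := by
  rw [Finset.mul_sum]
  refine Finset.sum_congr rfl fun j hj => ?_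
  have hj' : j ≤ n := Nat.lt_succ_iff.mp (Finset.mem_range.mp hj)
  rw [Nat.succ_sub hj', pow_succ]; ring

lemma U_sum (n : ℕ) (d y : ℂ) :
    ∑ k ∈ Finset.range (n + 1), Bp k (d + y) * y ^ (n - k) =
      ∑ j ∈ Finset.range (n + 1), ((n + 1).choose (j + 1) : ℂ) * Bp j d * y ^ (n - j) := by
  induction n with
  | zero => simp [Bp]
  | succ n ih =>
    rw [Finset.sum_range_succ, ← hom_mul, ih, hom_mul]
    simp only [Nat.sub_self, pow_zero, mul_one]
    rw [Bp_add]
    have : ∑ j ∈ Finset.range (n + 1), ((n + 1).choose (j + 1) : ℂ) * Bp j d * y ^ (n + 1 - j)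
      = ∑ j ∈ Finset.range (n + 1 + 1),
        ((n + 1).choose (j + 1) : ℂ) * Bp j d * y ^ (n + 1 - j) := by
      rw [Finset.sum_range_succ _ (n + 1)]; simp
    rw [this, ← Finset.sum_add_distrib]
    refine Finset.sum_congr rfl fun j _ => ?_
    rw [Nat.choose_succ_succ (n + 1) j]; push_cast; ring

lemma T_sum (n : ℕ) (d y : ℂ) :
    ∑ k ∈ Finset.range (n + 1), ((n : ℂ) + 1 - k) * Bp k (d + y) * y ^ (n - k) =
      ∑ j ∈ Finset.range (n + 1), ((n + 2).choose (j + 2) : ℂ) * Bp j d * y ^ (n - j) := by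
  induction n with
  | zero => simp [Bp]
  | succ n ih =>
    have e : ∑ k ∈ Finset.range (n + 1 + 1),
          (((n + 1 : ℕ) : ℂ) + 1 - k) * Bp k (d + y) * y ^ (n + 1 - k)
        = ∑ k ∈ Finset.range (n + 1 + 1), ((n : ℂ) + 1 - k) * Bp k (d + y) * y ^ (n + 1 - k)
          + ∑ k ∈ Finset.range (n + 1 + 1), Bp k (d + y) * y ^ (n + 1 - k) := by
      rw [← Finset.sum_add_distrib]
      refine Finset.sum_congr rfl fun j _ => ?_
      push_cast; ring
    rw [e, U_sum, Finset.sum_range_succ, ← hom_mul, ih, hom_mul]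
    have : ∑ j ∈ Finset.range (n + 1), ((n + 2).choose (j + 2) : ℂ) * Bp j d * y ^ (n + 1 - j)
      = ∑ j ∈ Finset.range (n + 1 + 1),
        ((n + 2).choose (j + 2) : ℂ) * Bp j d * y ^ (n + 1 - j) := by
      rw [Finset.sum_range_succ _ (n + 1)]; simp
    rw [this]
    have z : (n : ℂ) + 1 - ((n + 1 : ℕ) : ℂ) = 0 := by push_cast; ring
    rw [z, zero_mul, zero_mul, add_zero, ← Finset.sum_add_distrib]
    refine Finset.sum_congr rfl fun j _ => ?_
    rw [Nat.choose_succ_succ (n + 2) (j + 1)]; push_cast; ring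

lemma Q_sum (n : ℕ) (x y : ℂ) :
    (x - y) ^ 2 * ∑ k ∈ Finset.range (n + 1), ((k : ℂ) + 1) * x ^ k * y ^ (n - k) =
      (n + 1) * x ^ (n + 2) - (n + 2) * x ^ (n + 1) * y + y ^ (n + 2) := by
  induction n with
  | zero => simp; ring
  | succ n ih =>
    rw [Finset.sum_range_succ, ← hom_mul, mul_add, mul_left_comm, ih]
    push_cast
    simp
    ring

lemma P_sum (n : ℕ) (x y : ℂ) :
    (x - y) ^ 3 * ∑ k ∈ Finset.range (n + 1),
        ((k : ℂ) + 1) * ((n : ℂ) + 1 - k) * x ^ k * y ^ (n - k) =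
      (n + 3) * (x - y) * (x ^ (n + 2) + y ^ (n + 2)) - 2 * (x ^ (n + 3) - y ^ (n + 3)) := by
  induction n with
  | zero => simp; ring
  | succ n ih =>
    have e : ∑ k ∈ Finset.range (n + 1 + 1),
          ((k : ℂ) + 1) * (((n + 1 : ℕ) : ℂ) + 1 - k) * x ^ k * y ^ (n + 1 - k)
        = ∑ k ∈ Finset.range (n + 1 + 1),
            ((k : ℂ) + 1) * ((n : ℂ) + 1 - k) * x ^ k * y ^ (n + 1 - k)
          + ∑ k ∈ Finset.range (n + 1 + 1), ((k : ℂ) + 1) * x ^ k * y ^ (n + 1 - k) := by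
      rw [← Finset.sum_add_distrib]
      refine Finset.sum_congr rfl fun j _ => ?_
      push_cast; ring
    have z : (n : ℂ) + 1 - ((n + 1 : ℕ) : ℂ) = 0 := by push_cast; ring
    have q := Q_sum (n + 1) x y
    rw [e, mul_add, pow_succ (x - y) 2, mul_right_comm _ (x - y) (∑ k ∈ Finset.range (n + 1 + 1), ((k : ℂ) + 1) * x ^ k * y ^ (n + 1 - k)), q, Finset.sum_range_succ, ← hom_mul, z, ← pow_succ, mul_zero, zero_mul, zero_mul, add_zero, mul_left_comm, ih]
    push_cast
    ring

lemma P_sum' (n : ℕ) (x y : ℂ) :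
    (x - y) ^ 3 * ∑ k ∈ Finset.range (n + 1),
        ((k : ℂ) + 1) * ((n - k : ℕ) : ℂ) * x ^ k * y ^ (n - k - 1) =
      (n + 2) * (x - y) * (x ^ (n + 1) + y ^ (n + 1)) - 2 * (x ^ (n + 2) - y ^ (n + 2)) := by
  rcases n with _ | n
  · simp; ring
  · rw [Finset.sum_range_succ]
    simp only [Nat.sub_self, Nat.cast_zero, zero_mul, mul_zero, add_zero]
    have h := P_sum n x y
    have e : ∑ k ∈ Finset.range (n + 1),
        ((k : ℂ) + 1) * ((n + 1 - k : ℕ) : ℂ) * x ^ k * y ^ (n + 1 - k - 1) =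
        ∑ k ∈ Finset.range (n + 1),
        ((k : ℂ) + 1) * ((n : ℂ) + 1 - k) * x ^ k * y ^ (n - k) := by
      refine Finset.sum_congr rfl fun k hk => ?_
      have hk' : k ≤ n := Nat.lt_succ_iff.mp (Finset.mem_range.mp hk)
      obtain ⟨m, rfl⟩ := Nat.exists_eq_add_of_le hk'
      rw [show k + m + 1 - k = m + 1 by omega,
        show k + m - k = m by omega, show m + 1 - 1 = m by omega]
      push_cast; ring
    rw [e, h]
    push_cast; ring

/-- Difference of the two sides, with `x = d + y`. -/
noncomputable def FF (d : ℂ) (n : ℕ) (y : ℂ) : ℂ :=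
  ∑ k ∈ Finset.range (n + 1), Bp k (d + y) * Bp (n - k) y -
      ∑ k ∈ Finset.range (n + 1), ((n + 1).choose (k + 1) : ℂ) *
        (Bp k d * Bp (n - k) y + Bp k (-d) * Bp (n - k) (d + y)) / ((k : ℂ) + 2) -
    ((Bp (n + 1) (d + y) + Bp (n + 1) y) / d ^ 2 -
      (2 / ((n : ℂ) + 2)) * ((Bp (n + 2) (d + y) - Bp (n + 2) y) / d ^ 3))

lemma FF_poly (d : ℂ) (n : ℕ) : ∃ p : Polynomial ℂ, ∀ y, FF d n y = p.eval y := by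
  let b : ℕ → Polynomial ℂ := fun n => (Polynomial.bernoulli n).map (algebraMap ℚ ℂ)
  let c : ℕ → Polynomial ℂ := fun n => (b n).comp (Polynomial.C d + Polynomial.X)
  have hb : ∀ n y, Bp n y = (b n).eval y := fun n y => Bp_poly n y
  have hc : ∀ n y, Bp n (d + y) = (c n).eval y := fun n y => by
    rw [hb]; simp [c]
  refine ⟨∑ k ∈ Finset.range (n + 1), c k * b (n - k) -
      ∑ k ∈ Finset.range (n + 1), Polynomial.C (((n + 1).choose (k + 1) : ℂ)) *
        (Polynomial.C (Bp k d) * b (n - k) + Polynomial.C (Bp k (-d)) * c (n - k)) *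
          Polynomial.C (((k : ℂ) + 2)⁻¹) -
    ((c (n + 1) + b (n + 1)) * Polynomial.C ((d ^ 2)⁻¹) -
      Polynomial.C (2 / ((n : ℂ) + 2)) * ((c (n + 2) - b (n + 2)) * Polynomial.C ((d ^ 3)⁻¹))),
    fun y => ?_⟩
  simp only [Polynomial.eval_sub, Polynomial.eval_add, Polynomial.eval_mul, Polynomial.eval_C,
    Polynomial.eval_finsetSum, ← hc, ← hb, FF, div_eq_mul_inv]

lemma FF_deriv (d : ℂ) (n : ℕ) (y : ℂ) :
    HasDerivAt (FF d (n + 1)) ((n + 2) * FF d n y) y := by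
  have hb : ∀ n, HasDerivAt (Bp n) (n * Bp (n - 1) y) y := fun n => Bp_hasDerivAt n y
  have hc : ∀ n, HasDerivAt (fun y => Bp n (d + y)) (n * Bp (n - 1) (d + y)) y := fun n =>
    (Bp_hasDerivAt n (d + y)).comp_const_add d y
  have h1 := HasDerivAt.fun_sum (u := Finset.range (n + 1 + 1))
    (fun k _ => (hc k).fun_mul (hb (n + 1 - k)))
  have h2 := HasDerivAt.fun_sum (u := Finset.range (n + 1 + 1))
    (fun k _ => ((((hb (n + 1 - k)).const_mul (Bp k d)).fun_add
      ((hc (n + 1 - k)).const_mul (Bp k (-d)))).const_mul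
        (((n + 1 + 1).choose (k + 1) : ℂ))).div_const ((k : ℂ) + 2))
  have h3 := ((hc (n + 1 + 1)).fun_add (hb (n + 1 + 1))).div_const (d ^ 2)
  have h4 := (((hc (n + 1 + 2)).fun_sub (hb (n + 1 + 2))).div_const (d ^ 3)).const_mul
    (2 / (((n + 1 : ℕ) : ℂ) + 2))
  have h := (h1.fun_sub h2).fun_sub (h3.fun_sub h4)
  refine HasDerivAt.congr_deriv (f := FF d (n + 1)) h ?_
  have hn3 : (n : ℂ) + 3 ≠ 0 := by exact_mod_cast (Nat.succ_ne_zero (n + 2))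
  have hn2 : (n : ℂ) + 2 ≠ 0 := by exact_mod_cast (Nat.succ_ne_zero (n + 1))
  rw [FF, mul_sub, mul_sub]
  congr 1
  · congr 1
    · rw [Finset.sum_add_distrib, Finset.sum_range_succ', Finset.sum_range_succ _ (n + 1)]
      simp only [Nat.sub_self, Nat.cast_zero, zero_mul, mul_zero, add_zero]
      rw [← Finset.sum_add_distrib, Finset.mul_sum]
      refine Finset.sum_congr rfl fun k hk => ?_
      have hk' : k ≤ n := Nat.lt_succ_iff.mp (Finset.mem_range.mp hk)
      obtain ⟨m, rfl⟩ := Nat.exists_eq_add_of_le hk'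
      rw [show k + m + 1 - (k + 1) = m by omega, show k + m + 1 - k = m + 1 by omega,
        show k + m - k = m by omega, show m + 1 - 1 = m by omega, show k + 1 - 1 = k by omega]
      push_cast; ring
    · rw [Finset.sum_range_succ _ (n + 1)]
      simp only [Nat.sub_self, Nat.cast_zero, zero_mul, mul_zero, add_zero, zero_div]
      rw [Finset.mul_sum]
      refine Finset.sum_congr rfl fun k hk => ?_
      have hk' : k ≤ n := Nat.lt_succ_iff.mp (Finset.mem_range.mp hk)
      have hch := Nat.choose_mul_succ_eq (n + 1) (k + 1)
      obtain ⟨m, rfl⟩ := Nat.exists_eq_add_of_le hk'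
      rw [show k + m + 1 + 1 - (k + 1) = m + 1 by omega] at hch
      have hch' : ((k + m + 1).choose (k + 1) : ℂ) * (((k + m : ℕ) : ℂ) + 2) =
          ((k + m + 1 + 1).choose (k + 1) : ℂ) * ((m : ℂ) + 1) := by
        have := congrArg (Nat.cast : ℕ → ℂ) hch
        push_cast at this ⊢
        linear_combination this
      rw [show k + m + 1 - k = m + 1 by omega,
        show k + m - k = m by omega, show m + 1 - 1 = m by omega]
      rw [← mul_div_assoc]
      congr 1
      push_cast at hch' ⊢
      linear_combination (-(Bp k d * Bp m y) - (Bp k (-d) * Bp m (d + y))) * hch'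
  · simp only [show n + 1 + 1 - 1 = n + 1 by omega, show n + 1 + 2 - 1 = n + 2 by omega]
    have : (n : ℂ) + 1 + 2 ≠ 0 := by convert hn3 using 1; ring
    push_cast
    field_simp
    ring

lemma TT_sum (n : ℕ) (x y : ℂ) :
    ∑ k ∈ Finset.range (n + 1), ((n : ℂ) + 1 - k) * Bp k x * y ^ (n - k) =
      ∑ j ∈ Finset.range (n + 1), ((n + 2).choose (j + 2) : ℂ) * Bp j (x - y) * y ^ (n - j) := by
  have := T_sum n (x - y) y
  rwa [sub_add_cancel] at this

lemma FF_periodic (d : ℂ) (hd : d ≠ 0) (n : ℕ) (y : ℂ) :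
    FF d (n + 1) (y + 1) = FF d (n + 1) y := by
  have hn3 : (n : ℂ) + 1 + 2 ≠ 0 := by exact_mod_cast (Nat.succ_ne_zero (n + 2))
  -- first sum
  have h1 : ∑ k ∈ Finset.range (n + 1 + 1), Bp k (d + (y + 1)) * Bp (n + 1 - k) (y + 1) =
      ∑ k ∈ Finset.range (n + 1 + 1), Bp k (d + y) * Bp (n + 1 - k) y +
      (∑ k ∈ Finset.range (n + 1), ((n : ℂ) + 1 - k) * Bp k (d + y) * y ^ (n - k) +
       ∑ k ∈ Finset.range (n + 1), ((n : ℂ) + 1 - k) * Bp k y * (d + y) ^ (n - k) +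
       ∑ k ∈ Finset.range (n + 1),
        ((k : ℂ) + 1) * ((n - k : ℕ) : ℂ) * (d + y) ^ k * y ^ (n - k - 1)) := by
    have e : ∀ k ∈ Finset.range (n + 1 + 1), Bp k (d + (y + 1)) * Bp (n + 1 - k) (y + 1) =
        Bp k (d + y) * Bp (n + 1 - k) y +
        (((n + 1 - k : ℕ) : ℂ) * Bp k (d + y) * y ^ (n + 1 - k - 1) +
        (k : ℂ) * (Bp (n + 1 - k) y + ((n + 1 - k : ℕ) : ℂ) * y ^ (n + 1 - k - 1)) *
          (d + y) ^ (k - 1)) := by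
      intro k _
      rw [← add_assoc, Bp_shift, Bp_shift]; ring
    rw [Finset.sum_congr rfl e, Finset.sum_add_distrib, Finset.sum_add_distrib]
    congr 1
    conv_rhs => rw [add_assoc]
    congr 1
    · rw [Finset.sum_range_succ]
      simp only [Nat.sub_self, Nat.cast_zero, zero_mul, add_zero]
      refine Finset.sum_congr rfl fun k hk => ?_
      have hk' : k ≤ n := Nat.lt_succ_iff.mp (Finset.mem_range.mp hk)
      obtain ⟨m, rfl⟩ := Nat.exists_eq_add_of_le hk'
      rw [show k + m + 1 - k = m + 1 by omega,
        show k + m - k = m by omega, show m + 1 - 1 = m by omega]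
      push_cast; ring
    · rw [← Finset.sum_range_reflect (fun k => ((n : ℂ) + 1 - k) * Bp k y * (d + y) ^ (n - k)),
        Finset.sum_range_succ', ← Finset.sum_add_distrib]
      simp only [Nat.cast_zero, zero_mul, add_zero]
      refine Finset.sum_congr rfl fun k hk => ?_
      have hk' : k ≤ n := Nat.lt_succ_iff.mp (Finset.mem_range.mp hk)
      obtain ⟨m, rfl⟩ := Nat.exists_eq_add_of_le hk'
      rw [show k + m + 1 - (k + 1) = m by omega, show k + m + 1 - 1 - k = m by omega,
        show k + m - k = m by omega, show k + 1 - 1 = k by omega, show k + m - m = k by omega]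
      push_cast; ring
  have h2 : ∑ k ∈ Finset.range (n + 1 + 1), ((n + 1 + 1).choose (k + 1) : ℂ) *
        (Bp k d * Bp (n + 1 - k) (y + 1) + Bp k (-d) * Bp (n + 1 - k) (d + (y + 1))) /
          ((k : ℂ) + 2) =
      ∑ k ∈ Finset.range (n + 1 + 1), ((n + 1 + 1).choose (k + 1) : ℂ) *
        (Bp k d * Bp (n + 1 - k) y + Bp k (-d) * Bp (n + 1 - k) (d + y)) / ((k : ℂ) + 2) +
      (∑ j ∈ Finset.range (n + 1), ((n + 2).choose (j + 2) : ℂ) * Bp j d * y ^ (n - j) +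
       ∑ j ∈ Finset.range (n + 1),
        ((n + 2).choose (j + 2) : ℂ) * Bp j (-d) * (d + y) ^ (n - j)) := by
    have e : ∀ k ∈ Finset.range (n + 1 + 1), ((n + 1 + 1).choose (k + 1) : ℂ) *
        (Bp k d * Bp (n + 1 - k) (y + 1) + Bp k (-d) * Bp (n + 1 - k) (d + (y + 1))) /
          ((k : ℂ) + 2) =
        ((n + 1 + 1).choose (k + 1) : ℂ) *
        (Bp k d * Bp (n + 1 - k) y + Bp k (-d) * Bp (n + 1 - k) (d + y)) / ((k : ℂ) + 2) +
        ((n + 2).choose (k + 2) : ℂ) *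
          (Bp k d * y ^ (n + 1 - k - 1) + Bp k (-d) * (d + y) ^ (n + 1 - k - 1)) := by
      intro k hk
      have hch := congrArg (Nat.cast : ℕ → ℂ) (Nat.choose_succ_right_eq (n + 2) (k + 1))
      rw [show n + 2 - (k + 1) = n + 1 - k by omega] at hch
      have hk2 : (k : ℂ) + 2 ≠ 0 := by exact_mod_cast (Nat.succ_ne_zero (k + 1))
      rw [← add_assoc, Bp_shift, Bp_shift]
      rw [Nat.cast_mul, Nat.cast_mul] at hch
      rw [div_add' _ _ _ hk2]
      congr 1
      simp only [show n + 1 + 1 = n + 2 by omega, show k + 1 + 1 = k + 2 by omega] at hch ⊢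
      push_cast at hch
      have hch' : ((n + 2).choose (k + 2) : ℂ) * ((k : ℂ) + 2) =
        ((n + 2).choose (k + 1) : ℂ) * ((n + 1 - k : ℕ) : ℂ) := by
        rw [← hch]
      linear_combination
        (-(Bp k d * y ^ (n + 1 - k - 1) + Bp k (-d) * (d + y) ^ (n + 1 - k - 1))) * hch'
    rw [Finset.sum_congr rfl e, Finset.sum_add_distrib]
    congr 1
    rw [← Finset.sum_add_distrib, Finset.sum_range_succ, Nat.choose_eq_zero_of_lt (by omega : n + 2 < n + 1 + 2),
      Nat.cast_zero, zero_mul, add_zero]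
    refine Finset.sum_congr rfl fun k hk => ?_
    rw [show n + 1 - k - 1 = n - k by omega]
    ring
  have t1 := TT_sum n (d + y) y
  have t2 := TT_sum n y (d + y)
  rw [show d + y - y = d by ring] at t1
  rw [show y - (d + y) = -d by ring] at t2
  have p := P_sum' n (d + y) y
  rw [show d + y - y = d by ring] at p
  have p' := eq_div_of_mul_eq (pow_ne_zero 3 hd) ((mul_comm _ _).trans p)
  rw [FF, FF, h1, h2, t1, t2, p', ← add_assoc d y 1]
  simp only [Bp_shift, show n + 1 + 1 - 1 = n + 1 by omega, show n + 1 + 2 - 1 = n + 2 by omega]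
  push_cast
  field_simp
  ring

theorem pan_sun_matiyasevich (n : ℕ) (x y : ℂ) (hxy : x ≠ y) :
    ∑ k ∈ Finset.range (n + 1), Bp k x * Bp (n - k) y -
      ∑ k ∈ Finset.range (n + 1), ((n + 1).choose (k + 1) : ℂ) *
        (Bp k (x - y) * Bp (n - k) y + Bp k (y - x) * Bp (n - k) x) / ((k : ℂ) + 2) =
    (Bp (n + 1) x + Bp (n + 1) y) / (x - y) ^ 2 -
      (2 / ((n : ℂ) + 2)) * ((Bp (n + 2) x - Bp (n + 2) y) / (x - y) ^ 3) := by
  have hd : x - y ≠ 0 := sub_ne_zero.mpr hxy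
  obtain ⟨p, hp⟩ := FF_poly (x - y) (n + 1)
  have hnat : ∀ m : ℕ, p.eval (m : ℂ) = p.eval 0 := by
    intro m
    induction m with
    | zero => simp
    | succ m ih =>
      rw [← ih, ← hp, ← hp, Nat.cast_succ, FF_periodic _ hd]
  have hpc : p = Polynomial.C (p.eval 0) := by
    apply Polynomial.eq_of_infinite_eval_eq
    refine Set.Infinite.mono ?_ (Set.infinite_range_of_injective (Nat.cast_injective (R := ℂ)))
    rintro _ ⟨m, rfl⟩
    simp [hnat m]
  have hconst : FF (x - y) (n + 1) = fun _ => p.eval 0 := by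
    funext z
    rw [hp, hpc]; simp
  have h1 := FF_deriv (x - y) n y
  rw [hconst] at h1
  have h2 := h1.unique (hasDerivAt_const y (p.eval 0))
  have hn2 : (n : ℂ) + 2 ≠ 0 := by exact_mod_cast (Nat.succ_ne_zero (n + 1))
  have h3 := (mul_eq_zero.mp h2).resolve_left hn2
  rw [FF, sub_eq_zero] at h3
  simpa only [sub_add_cancel, neg_sub] using h3
end

section
/- Let n be a nonnegative integer and let r, s, t be complex numbers with r + s + t = n, and x, y, z complex with x + y + z = 1. Define [s,t;x,y]_n = ∑_{k=0}^n (−1)^k C(s,k) C(t,n−k) B_{n−k}(x) B_k(y), where C(s,k) is the generalized binomial coefficient s(s−1)⋯(s−k+1)/k!. Then r·[s,t;x,y]_n + s·[t,r;y,z]_n + t·[r,s;z,x]_n = 0. -/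
/-- The generalized binomial coefficient `C(r,k) = r(r-1)⋯(r-k+1)/k!` for complex `r`. -/
noncomputable def gchoose (r : ℂ) (k : ℕ) : ℂ :=
  (∏ i ∈ Finset.range k, (r - i)) / (k.factorial : ℂ)

/-- The bracket `[s,t;x,y]_n` of Sun and Pan. -/
noncomputable def brak (n : ℕ) (s t x y : ℂ) : ℂ :=
  ∑ k ∈ Finset.range (n + 1),
    (-1) ^ k * gchoose s k * gchoose t (n - k) * Bp (n - k) x * Bp k y

namespace SunPan
open PowerSeries

noncomputable def E {A : Type*} [CommRing A] [Algebra ℚ A] (a : A) : PowerSeries A :=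
  rescale a (exp A)

noncomputable def G {A : Type*} [CommRing A] [Algebra ℚ A] (a x : A) : PowerSeries A :=
  rescale a (PowerSeries.mk fun n => Polynomial.aeval x ((1 / (n.factorial : ℚ)) • Polynomial.bernoulli n))

variable {A : Type*} [CommRing A] [Algebra ℚ A]

lemma E_add (a b : A) : E (a + b) = E a * E b := (exp_mul_exp_eq_exp_add a b).symm

lemma E_zero : E (0 : A) = 1 := by
  simp [E, rescale_zero]

lemma G_eq (a x : A) : (E a - 1) * G a x = PowerSeries.C a * PowerSeries.X * E (x * a) := by
  have h := congrArg (rescale a) (Polynomial.bernoulli_generating_function x)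
  rw [map_mul, map_mul, map_sub, map_one, rescale_X, rescale_rescale] at h
  rw [mul_comm]
  exact h

lemma G_neg_eq (a x : A) :
    (E a - 1) * G (-a) x = PowerSeries.C a * PowerSeries.X * E (a * (1 - x)) := by
  have h := G_eq (-a) x
  have h1 : E a * E (-a) = 1 := by rw [← E_add]; simp [E_zero]
  have h2 : E (a * (1 - x)) = E a * E (x * -a) := by rw [← E_add]; congr 1; ring
  rw [map_neg] at h
  rw [h2]
  linear_combination (-E a) * h + G (-a) x * h1

lemma E_sub_ne [IsDomain A] (a : A) (ha : a ≠ 0) : E a - 1 ≠ 0 := by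
  intro h
  have := congrArg (PowerSeries.coeff 1) h
  simp [E, coeff_rescale, coeff_exp, PowerSeries.coeff_one] at this
  exact ha this

lemma key [IsDomain A] (p q w x y z : A) (hp : p ≠ 0) (hq : q ≠ 0) (hw : w ≠ 0)
    (h : p + q + w = 0) (hx : x + y + z = 1) :
    PowerSeries.C w * (G p x * G (-q) y) + PowerSeries.C q * (G w y * G (-p) z)
      + PowerSeries.C p * (G q z * G (-w) x) = 0 := by
  have hne : (E p - 1) * (E q - 1) * (E w - 1) ≠ 0 :=
    mul_ne_zero (mul_ne_zero (E_sub_ne p hp) (E_sub_ne q hq)) (E_sub_ne w hw)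
  apply (mul_eq_zero.mp _).resolve_left hne
  obtain rfl : w = -p - q := by linear_combination h
  obtain rfl : z = 1 - x - y := by linear_combination hx
  set w := -p - q with hw'
  set z := 1 - x - y with hz'
  have e1 : E (x * p) * E (q * (1 - y)) = E (p * x - q * y) * E q := by
    rw [← E_add, ← E_add]; congr 1; ring
  have e2 : E (y * w) * E (p * (1 - z)) = E (p * x - q * y) := by
    rw [← E_add]; congr 1; simp only [hw', hz']; ring
  have e3 : E (z * q) * E (w * (1 - x)) = E (p * x - q * y) * E (-p) := by
    rw [← E_add, ← E_add]; congr 1; simp only [hw', hz']; ring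
  have e4 : E q * E w = E (-p) := by
    rw [← E_add]; congr 1; simp only [hw']; ring
  have e5 : E (-p) * E p = 1 := by rw [← E_add]; simp [E_zero]
  have T1 : ((E p - 1) * G p x) * ((E q - 1) * G (-q) y) =
      PowerSeries.C p * PowerSeries.C q * PowerSeries.X ^ 2 * (E (p * x - q * y) * E q) := by
    rw [G_eq, G_neg_eq, ← e1]; ring
  have T2 : ((E w - 1) * G w y) * ((E p - 1) * G (-p) z) =
      PowerSeries.C w * PowerSeries.C p * PowerSeries.X ^ 2 * E (p * x - q * y) := by
    rw [G_eq, G_neg_eq, ← e2]; ring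
  have T3 : ((E q - 1) * G q z) * ((E w - 1) * G (-w) x) =
      PowerSeries.C q * PowerSeries.C w * PowerSeries.X ^ 2 * (E (p * x - q * y) * E (-p)) := by
    rw [G_eq, G_neg_eq, ← e3]; ring
  linear_combination (PowerSeries.C w * (E w - 1)) * T1 + (PowerSeries.C q * (E q - 1)) * T2
    + (PowerSeries.C p * (E p - 1)) * T3
    + PowerSeries.C p * PowerSeries.C q * PowerSeries.C w * PowerSeries.X ^ 2
      * E (p * x - q * y) * (e4 + e5)

/-- falling factorial -/
noncomputable def D (r : ℂ) (k : ℕ) : ℂ := ∏ i ∈ Finset.range k, (r - i)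

lemma D_succ (r : ℂ) (k : ℕ) : D r (k + 1) = D r k * (r - k) := Finset.prod_range_succ _ _

noncomputable def L (n : ℕ) (s t : ℂ) : Polynomial ℂ →ₗ[ℂ] ℂ :=
  ∑ i ∈ Finset.range (n + 2), (D t i * D s (n + 1 - i)) • Polynomial.lcoeff ℂ i

lemma L_mon (n : ℕ) (r s t : ℂ) (h : r + s + t = n) (l : ℕ) : ∀ i j : ℕ, i + j + l = n + 1 →
    L n s t (Polynomial.X ^ i * (-Polynomial.X - 1) ^ l) = D t i * D s j * D r l := by
  induction l with
  | zero =>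
    intro i j hij
    have hj : n + 1 - i = j := by omega
    have hi : i < n + 2 := by omega
    simp [L, Polynomial.coeff_X_pow, hi, hj, D]
  | succ l ih =>
    intro i j hij
    have e : (Polynomial.X ^ i * (-Polynomial.X - 1) ^ (l + 1) : Polynomial ℂ) =
      -(Polynomial.X ^ (i + 1) * (-Polynomial.X - 1) ^ l)
        - Polynomial.X ^ i * (-Polynomial.X - 1) ^ l := by ring
    rw [e, map_sub, map_neg, ih (i + 1) j (by omega), ih i (j + 1) (by omega),
      D_succ, D_succ, D_succ]
    have hc : (i : ℂ) + j + l = n := by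
      have : i + j + l = n := by omega
      exact_mod_cast this
    linear_combination D t i * D s j * D r l * (hc - h)

lemma coeff_G (a : Polynomial ℂ) (x : ℂ) (k : ℕ) :
    PowerSeries.coeff k (G a (Polynomial.C x)) = Polynomial.C (Bp k x / (k.factorial : ℂ)) * a ^ k := by
  have : Polynomial.aeval (Polynomial.C x) (Polynomial.bernoulli k) = Polynomial.C (Bp k x) := by
    unfold Bp
    exact Polynomial.aeval_algebraMap_apply (Polynomial ℂ) x (Polynomial.bernoulli k)
  rw [G, coeff_rescale, coeff_mk, map_smul, this, mul_comm, Polynomial.smul_C, Algebra.smul_def]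
  congr 2
  simp
  ring

lemma term (n : ℕ) (s t x y a : ℂ) (W P Q : Polynomial ℂ) (M : Polynomial ℂ →ₗ[ℂ] ℂ)
    (h : ∀ i j, i + j = n → M (W * (P ^ i * Q ^ j)) = a * (D t i * D s j)) :
    M (PowerSeries.coeff n (PowerSeries.C W *
      (G P (Polynomial.C x) * G (-Q) (Polynomial.C y)))) = a * brak n s t x y := by
  rw [PowerSeries.coeff_C_mul, mul_comm (G P _), PowerSeries.coeff_mul, Finset.Nat.sum_antidiagonal_eq_sum_range_succ_mk, brak,
    Finset.mul_sum, Finset.mul_sum, map_sum]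
  refine Finset.sum_congr rfl fun k hk => ?_
  have hk' : n - k + k = n := by have := Finset.mem_range.mp hk; omega
  simp only [coeff_G]
  have e : W * (Polynomial.C (Bp k y / (k.factorial : ℂ)) * (-Q) ^ k *
      (Polynomial.C (Bp (n - k) x / ((n - k).factorial : ℂ)) * P ^ (n - k))) =
      ((-1) ^ k * (Bp k y / (k.factorial : ℂ)) * (Bp (n - k) x / ((n - k).factorial : ℂ))) •
        (W * (P ^ (n - k) * Q ^ k)) := by
    rw [neg_pow, Polynomial.smul_eq_C_mul]
    simp only [map_mul, map_pow, map_neg, map_one]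
    ring
  rw [e, map_smul, h _ _ hk', smul_eq_mul]
  simp only [gchoose, D]
  ring

end SunPan

/-- The Sun–Pan symmetric identity. -/
theorem sun_pan (n : ℕ) (r s t x y z : ℂ) (hrst : r + s + t = n) (hxyz : x + y + z = 1) :
    r * brak n s t x y + s * brak n t r y z + t * brak n r s z x = 0 := by
  have hw : (-Polynomial.X - 1 : Polynomial ℂ) ≠ 0 := by
    intro h
    have := congrArg (fun f => Polynomial.coeff f 1) h
    simp [Polynomial.coeff_one] at this
  have k := SunPan.key (A := Polynomial ℂ) Polynomial.X 1 (-Polynomial.X - 1)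
    (Polynomial.C x) (Polynomial.C y) (Polynomial.C z) Polynomial.X_ne_zero one_ne_zero hw
    (by ring) (by rw [← map_add, ← map_add, hxyz, map_one])
  have k2 := congrArg (fun f => SunPan.L n s t (PowerSeries.coeff n f)) k
  simp only [map_add, map_zero] at k2
  have D1 : ∀ a, SunPan.D a 1 = a := by intro a; simp [SunPan.D]
  have hL := SunPan.L_mon n r s t hrst
  rw [SunPan.term n s t x y r _ _ _ _ ?h1, SunPan.term n t r y z s _ _ _ _ ?h2,
    SunPan.term n r s z x t _ _ _ _ ?h3] at k2
  case h1 =>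
    intro i j hij
    have := hL 1 i j (by omega)
    rw [D1, pow_one] at this
    rw [one_pow, mul_one, mul_comm, this]; ring
  case h2 =>
    intro i j hij
    have := hL i j 1 (by omega)
    rw [D1] at this
    rw [one_mul, mul_comm (_ ^ i), this]; ring
  case h3 =>
    intro i j hij
    have := hL j 1 i (by omega)
    rw [D1, pow_one] at this
    rw [one_pow, one_mul, this]; ring
  exact k2
end

section
/- Let m, n be positive integers and p_1,…,p_m complex numbers that are not integers, with p_{m+1} := −(p_1+⋯+p_m+n) also not a nonpositive integer. Then Γ(p_{m+1}+1) ∑_{k_1+⋯+k_m=n} ∏_{j=1}^m [Γ(p_j+k_j)/Γ(k_j+1)] B_{k_j}(x_j) = − ∑_{i=1}^m Γ(p_i+1) ∑_{k_1+⋯+k_m=n} [Γ(p_{m+1}+k_i)/Γ(k_i+1)] B_{k_i}(1−x_i) ∏_{j≠i} [Γ(p_j+k_j)/Γ(k_j+1)] B_{k_j}(x_j − x_i + 1_{j>i}). -/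
namespace GB

open PowerSeries

/-- Generating series with coefficients `(p)_k / k! * φ_k(y)`. -/
noncomputable def S (φ : ℕ → ℂ → ℂ) (p y : ℂ) : PowerSeries ℂ :=
  PowerSeries.mk fun k => (ascPochhammer ℂ k).eval p / (k.factorial : ℂ) * φ k y

/-- The Bernoulli series. -/
noncomputable abbrev A (p y : ℂ) : PowerSeries ℂ := S Bp p y

/-- The power series `(1 - y t)^(-p)`. -/
noncomputable abbrev E (p y : ℂ) : PowerSeries ℂ := S (fun k y => y ^ k) p y

/-- Coefficientwise derivative. -/
def HasPD (F DF : ℂ → PowerSeries ℂ) : Prop :=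
  ∀ k z, HasDerivAt (fun z => coeff k (F z)) (coeff k (DF z)) z

/-- Appell sequences. -/
def Appell (φ : ℕ → ℂ → ℂ) : Prop :=
  (∀ y, φ 0 y = 1) ∧ ∀ k y, HasDerivAt (φ (k + 1)) (((k : ℂ) + 1) * φ k y) y

theorem HasPD.mul {F DF G DG : ℂ → PowerSeries ℂ} (hF : HasPD F DF) (hG : HasPD G DG) :
    HasPD (fun z => F z * G z) (fun z => DF z * G z + F z * DG z) := by
  intro k z
  simp only [coeff_mul, map_add, ← Finset.sum_add_distrib]
  exact HasDerivAt.fun_sum fun x _ => (hF x.1 z).mul (hG x.2 z)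

/-- The basic differential equation for a family of weight `p`. -/
def Good (p : ℂ) (F : ℂ → PowerSeries ℂ) : Prop :=
  HasPD F (fun z => -(X * (C p * F z + X * d⁄dX ℂ (F z))))

theorem Good.mul {p q : ℂ} {F G : ℂ → PowerSeries ℂ} (hF : Good p F) (hG : Good q G) :
    Good (p + q) (fun z => F z * G z) := by
  have h := HasPD.mul hF hG
  unfold Good
  convert h using 2 with z
  rw [Derivation.leibniz, map_add, smul_eq_mul, smul_eq_mul]
  ring

theorem Good.one : Good 0 (fun _ => 1) := by
  intro k z
  simpa using hasDerivAt_const z (coeff k (1 : PowerSeries ℂ))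

theorem Good.prod {ι : Type*} (s : Finset ι) (p : ι → ℂ) (F : ι → ℂ → PowerSeries ℂ)
    (h : ∀ i ∈ s, Good (p i) (F i)) : Good (∑ i ∈ s, p i) (fun z => ∏ i ∈ s, F i z) := by
  classical
  induction s using Finset.induction_on with
  | empty => simpa using Good.one
  | insert a s ha ih =>
    simp only [Finset.sum_insert ha, Finset.prod_insert ha]
    exact Good.mul (h a (by simp)) (ih fun i hi => h i (by simp [hi]))

theorem Good.deriv_coeff {p : ℂ} {F : ℂ → PowerSeries ℂ} (h : Good p F) (k : ℕ) (z : ℂ) :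
    HasDerivAt (fun z => coeff (k + 1) (F z)) (-((p + k) * coeff k (F z))) z := by
  have h1 := h (k + 1) z
  convert h1 using 1
  rw [map_neg, coeff_succ_X_mul, map_add, coeff_C_mul]
  rcases k with _ | k
  · simp
  · rw [coeff_succ_X_mul, coeff_derivative]
    push_cast
    ring

theorem Good.const {p : ℂ} {F : ℂ → PowerSeries ℂ} (h : Good p F) (k : ℕ)
    (hp : p = 1 - k) (z w : ℂ) : coeff k (F z) = coeff k (F w) := by
  have key : ∀ z, HasDerivAt (fun z => coeff k (F z)) 0 z := by
    intro z
    rcases k with _ | k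
    · simpa using h 0 z
    · convert h.deriv_coeff k z using 1
      rw [hp]; push_cast; ring
  exact is_const_of_deriv_eq_zero (fun z => (key z).differentiableAt) (fun z => (key z).deriv) z w

theorem asc_succ_left (k : ℕ) (p : ℂ) :
    (ascPochhammer ℂ (k + 1)).eval p = p * (ascPochhammer ℂ k).eval (p + 1) := by
  rw [ascPochhammer_succ_left]; simp

theorem fact_ne (k : ℕ) : ((k.factorial : ℕ) : ℂ) ≠ 0 := by
  exact_mod_cast Nat.factorial_ne_zero k

theorem S_hasPD {φ : ℕ → ℂ → ℂ} (h : Appell φ) (p : ℂ) :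
    HasPD (S φ p) (fun y => C p * (X * S φ (p + 1) y)) := by
  intro k y
  rcases k with _ | k
  · simp only [S, coeff_mk, h.1]
    simpa using hasDerivAt_const y (1 : ℂ)
  · rw [coeff_C_mul, coeff_succ_X_mul]
    simp only [S, coeff_mk]
    refine ((h.2 k y).const_mul _).congr_deriv ?_
    rw [asc_succ_left, Nat.factorial_succ]
    have := fact_ne k
    have h2 : (k : ℂ) + 1 ≠ 0 := by exact_mod_cast Nat.succ_ne_zero k
    push_cast
    field_simp

theorem S_ode (φ : ℕ → ℂ → ℂ) (p y : ℂ) :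
    C p * S φ (p + 1) y = C p * S φ p y + X * d⁄dX ℂ (S φ p y) := by
  ext k
  have e : (ascPochhammer ℂ k).eval p * (p + k) = p * (ascPochhammer ℂ k).eval (p + 1) := by
    rw [← asc_succ_left, ascPochhammer_succ_eval]
  have hk : coeff k (X * d⁄dX ℂ (S φ p y)) = k * coeff k (S φ p y) := by
    rcases k with _ | k
    · simp
    · rw [coeff_succ_X_mul, coeff_derivative]; push_cast; ring
  rw [map_add, hk, coeff_C_mul, coeff_C_mul]
  simp only [S, coeff_mk]
  linear_combination (-(φ k y) / (k.factorial : ℂ)) * e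

theorem S_good {φ : ℕ → ℂ → ℂ} (h : Appell φ) (p w : ℂ) :
    Good p (fun z => S φ p (w - z)) := by
  intro k z
  have h1 := (S_hasPD h p k (w - z)).comp z ((hasDerivAt_id z).const_sub w)
  refine h1.congr_deriv ?_
  beta_reduce
  rw [← S_ode]
  rw [show X * (C p * S φ (p + 1) (w - z)) = C p * (X * S φ (p + 1) (w - z)) by ring]
  simp

theorem S_hasPD_right {φ : ℕ → ℂ → ℂ} (h : Appell φ) (p w : ℂ) :
    HasPD (fun z => S φ p (z - w)) (fun z => C p * (X * S φ (p + 1) (z - w))) := by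
  intro k z
  have h1 := (S_hasPD h p k (z - w)).comp z ((hasDerivAt_id z).sub_const w)
  refine h1.congr_deriv ?_
  simp

theorem appell_pow : Appell (fun k y => y ^ k) := by
  refine ⟨by simp, fun k y => ?_⟩
  simpa using hasDerivAt_pow (k + 1) y

theorem appell_Bp : Appell Bp := by
  refine ⟨by simp [Bp], fun k y => ?_⟩
  have := Polynomial.hasDerivAt_aeval (Polynomial.bernoulli (k + 1)) y
  rw [Polynomial.derivative_bernoulli_add_one] at this
  refine this.congr_deriv ?_
  simp [Bp]

theorem Bp_add_one (k : ℕ) (y : ℂ) : Bp k (y + 1) = Bp k y + k * y ^ (k - 1) := by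
  have := congrArg (Polynomial.aeval y) (Polynomial.bernoulli_comp_one_add_X k)
  rw [Polynomial.aeval_comp] at this
  simpa [Bp, add_comm] using this

theorem A_diff (p y : ℂ) : A p (y + 1) = A p y + C p * (X * E (p + 1) y) := by
  ext k
  rw [map_add, coeff_C_mul]
  rcases k with _ | k
  · simp [S, Bp]
  · rw [coeff_succ_X_mul]
    simp only [S, coeff_mk, Bp_add_one]
    rw [asc_succ_left, Nat.factorial_succ]
    have := fact_ne k
    have h2 : (k : ℂ) + 1 ≠ 0 := by exact_mod_cast Nat.succ_ne_zero k
    push_cast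
    field_simp

theorem E_zero (p : ℂ) : E p 0 = 1 := by
  ext k
  rcases k with _ | k <;> simp [S, coeff_one]

/-- Polynomial functions. -/
def PolyF (f : ℂ → ℂ) : Prop := ∃ P : Polynomial ℂ, ∀ s, f s = P.eval s

theorem PolyF.add {f g : ℂ → ℂ} (hf : PolyF f) (hg : PolyF g) : PolyF (fun s => f s + g s) := by
  obtain ⟨P, hP⟩ := hf
  obtain ⟨Q, hQ⟩ := hg
  exact ⟨P + Q, fun s => by simp [hP, hQ]⟩

theorem PolyF.mul {f g : ℂ → ℂ} (hf : PolyF f) (hg : PolyF g) : PolyF (fun s => f s * g s) := by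
  obtain ⟨P, hP⟩ := hf
  obtain ⟨Q, hQ⟩ := hg
  exact ⟨P * Q, fun s => by simp [hP, hQ]⟩

theorem PolyF.const (c : ℂ) : PolyF (fun _ => c) := ⟨Polynomial.C c, by simp⟩

theorem PolyF.sum {ι : Type*} (s : Finset ι) (f : ι → ℂ → ℂ) (h : ∀ i ∈ s, PolyF (f i)) :
    PolyF (fun z => ∑ i ∈ s, f i z) := by
  classical
  induction s using Finset.induction_on with
  | empty => simpa using PolyF.const 0
  | insert a s ha ih =>
    simp only [Finset.sum_insert ha]
    exact PolyF.add (h a (by simp)) (ih fun i hi => h i (by simp [hi]))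

/-- Power series with polynomial coefficients. -/
def PolyS (F : ℂ → PowerSeries ℂ) : Prop := ∀ k, PolyF (fun z => coeff k (F z))

theorem PolyS.const (c : PowerSeries ℂ) : PolyS (fun _ => c) := fun _ => PolyF.const _

theorem PolyS.mul {F G : ℂ → PowerSeries ℂ} (hF : PolyS F) (hG : PolyS G) :
    PolyS (fun z => F z * G z) := by
  intro k
  simp only [coeff_mul]
  exact PolyF.sum _ _ fun x _ => (hF _).mul (hG _)

theorem PolyS.prod {ι : Type*} (s : Finset ι) (F : ι → ℂ → PowerSeries ℂ)
    (h : ∀ i ∈ s, PolyS (F i)) : PolyS (fun z => ∏ i ∈ s, F i z) := by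
  classical
  induction s using Finset.induction_on with
  | empty => simpa using PolyS.const 1
  | insert a s ha ih =>
    simp only [Finset.prod_insert ha]
    exact PolyS.mul (h a (by simp)) (ih fun i hi => h i (by simp [hi]))

theorem A_poly (p : ℂ) (Q : Polynomial ℂ) : PolyS (fun z => A p (Q.eval z)) := by
  intro k
  simp only [S, coeff_mk]
  refine PolyF.mul (PolyF.const _) ⟨((Polynomial.bernoulli k).map (algebraMap ℚ ℂ)).comp Q, ?_⟩
  intro s
  simp [Bp, Polynomial.aeval_def, Polynomial.eval_map]

theorem PolyF.periodic {f : ℂ → ℂ} (hf : PolyF f) (h : ∀ s, f (s + 1) = f s) (s : ℂ) :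
    f s = f 0 := by
  obtain ⟨P, hP⟩ := hf
  have hn : ∀ n : ℕ, f n = f 0 := by
    intro n
    induction n with
    | zero => simp
    | succ n ih => push_cast; rw [h, ih]
  have : P = Polynomial.C (f 0) := by
    apply Polynomial.eq_of_infinite_eval_eq
    apply (Set.infinite_range_of_injective (Nat.cast_injective (R := ℂ))).mono
    rintro _ ⟨n, rfl⟩
    simp [← hP, hn]
  rw [hP, this]; simp


section core

variable {ι : Type*} [Fintype ι] [LinearOrder ι]

/-- The indicator `1_{i<j}`. -/
noncomputable abbrev ind (i j : ι) : ℂ := if i < j then 1 else 0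

/-- The cyclic sum. -/
noncomputable def G (n : ℕ) (a : ℂ) (p x : ι → ℂ) (s : ℂ) : ℂ :=
  a * coeff n (∏ j, A (p j) (x j - s + 1)) +
    ∑ i, p i * coeff n (A a (s - x i) *
      ∏ j ∈ Finset.univ.erase i, A (p j) (x j - x i + ind i j))

theorem prod_diff (p x : ι → ℂ) (s : ℂ) :
    ∏ j, A (p j) (x j - s) = ∏ j, A (p j) (x j - s + 1) -
      ∑ i, C (p i) * (X * (E (p i + 1) (x i - s) *
        ∏ j ∈ Finset.univ.erase i, A (p j) (x j - s + ind i j))) := by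
  have h := Finset.prod_add_ordered Finset.univ (fun j => A (p j) (x j - s + 1))
    (fun j => -(C (p j) * (X * E (p j + 1) (x j - s))))
  have e : ∀ j, A (p j) (x j - s + 1) + -(C (p j) * (X * E (p j + 1) (x j - s)))
      = A (p j) (x j - s) := by
    intro j; rw [A_diff]; ring
  simp only [e] at h
  rw [h, sub_eq_add_neg, ← Finset.sum_neg_distrib]
  congr 1
  refine Finset.sum_congr rfl fun i _ => ?_
  have hsplit : ∏ j ∈ Finset.univ.erase i, A (p j) (x j - s + ind i j) =
      (∏ j with j < i, A (p j) (x j - s)) * ∏ j with i < j, A (p j) (x j - s + 1) := by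
    rw [← Finset.prod_filter_mul_prod_filter_not (Finset.univ.erase i) (fun j => j < i)]
    congr 1
    · refine Finset.prod_congr ?_ ?_
      · ext j; simp; exact fun h => h.ne
      · intro j hj
        simp at hj
        simp [ind, not_lt.2 hj.le]
    · refine Finset.prod_congr ?_ ?_
      · ext j; simp; exact ⟨fun h => lt_of_le_of_ne h.2 (Ne.symm h.1), fun h => ⟨h.ne', h.le⟩⟩
      · intro j hj
        simp at hj
        simp [ind, hj]
  rw [hsplit]; ring

theorem swap (K : ℕ) (t : Finset ι) (a b : ℂ) (p w : ι → ℂ) (s x : ℂ)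
    (h : a + b + ∑ j ∈ t, p j = -((K : ℂ) + 1)) :
    coeff K (E (b + 1) (x - s) * ∏ j ∈ t, A (p j) (w j - s)) =
      coeff K (E (a + 1) (s - x) * ∏ j ∈ t, A (p j) (w j - x)) := by
  have g := ((S_good appell_pow (b + 1) x).mul (S_good appell_pow (a + 1) s)).mul
    (Good.prod t p (fun j z => A (p j) (w j - z)) fun j _ => S_good appell_Bp (p j) (w j))
  have := g.const K (by linear_combination h) s x
  simpa [E_zero] using this

theorem G_periodic (n : ℕ) (a : ℂ) (p x : ι → ℂ) (h : a + ∑ j, p j = -((n : ℂ) + 1)) (s : ℂ) :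
    G (n + 1) a p x (s + 1) = G (n + 1) a p x s := by
  unfold G
  have e1 : ∀ j, x j - (s + 1) + 1 = x j - s := fun j => by ring
  have e2 : ∀ i, A a (s + 1 - x i) = A a (s - x i) + C a * (X * E (a + 1) (s - x i)) := by
    intro i; rw [← A_diff]; congr 1; ring
  simp only [e1, e2]
  rw [prod_diff, map_sub, map_sum, mul_sub, Finset.mul_sum, sub_add, sub_eq_add_neg]
  congr 1
  rw [← Finset.sum_sub_distrib, ← Finset.sum_neg_distrib]
  refine Finset.sum_congr rfl fun i _ => ?_
  have hs := swap n (Finset.univ.erase i) a (p i) p (fun j => x j + ind i j) s (x i) (by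
    rw [← h, ← Finset.add_sum_erase _ _ (Finset.mem_univ i)]; ring)
  have e3 : ∀ (u : ℂ) j, x j - u + ind i j = x j + ind i j - u := fun u j => by ring
  simp only [e3, add_mul, map_add]
  rw [coeff_C_mul, coeff_succ_X_mul, hs, mul_assoc, mul_assoc, coeff_C_mul, coeff_succ_X_mul]
  ring

theorem G_poly (n : ℕ) (a : ℂ) (p x : ι → ℂ) : PolyF (G n a p x) := by
  unfold G
  refine PolyF.add (PolyF.mul (PolyF.const _) ?_) (PolyF.sum _ _ fun i _ =>
    PolyF.mul (PolyF.const _) ?_)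
  · refine PolyS.prod Finset.univ (fun j s => A (p j) (x j - s + 1)) (fun j _ => ?_) n
    have := A_poly (p j) (Polynomial.C (x j) - Polynomial.X + 1)
    simpa using this
  · refine PolyS.mul ?_ (PolyS.const _) n
    have := A_poly a (Polynomial.X - Polynomial.C (x i))
    simpa using this

theorem G_deriv (n : ℕ) (a : ℂ) (p x : ι → ℂ) (h : a + ∑ j, p j = -((n : ℂ) + 1)) (s : ℂ) :
    HasDerivAt (G (n + 1) a p x) (a * G n (a + 1) p x s) s := by
  have h1 := (Good.prod Finset.univ p (fun j z => A (p j) (x j + 1 - z))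
    (fun j _ => S_good appell_Bp (p j) (x j + 1))).deriv_coeff n s
  have h2 : ∀ i, HasDerivAt (fun s => coeff (n + 1) (A a (s - x i) *
      ∏ j ∈ Finset.univ.erase i, A (p j) (x j - x i + ind i j)))
      (a * coeff n (A (a + 1) (s - x i) *
      ∏ j ∈ Finset.univ.erase i, A (p j) (x j - x i + ind i j))) s := by
    intro i
    have hc : HasPD (fun _ => ∏ j ∈ Finset.univ.erase i, A (p j) (x j - x i + ind i j))
        (fun _ => 0) := by
      intro k z
      simpa using hasDerivAt_const z _
    refine ((S_hasPD_right appell_Bp a (x i)).mul hc (n + 1) s).congr_deriv ?_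
    beta_reduce
    rw [mul_zero, add_zero, mul_assoc, mul_assoc, coeff_C_mul, coeff_succ_X_mul]
  have h3 := (h1.const_mul a).add
    (HasDerivAt.fun_sum fun i (_ : i ∈ Finset.univ) => (h2 i).const_mul (p i))
  have e : ∀ u j, x j - u + 1 = x j + 1 - u := fun u j => by ring
  have hG : G (n + 1) a p x = ((fun y => a * coeff (n + 1) (∏ j, A (p j) (x j + 1 - y))) +
      fun y => ∑ i, p i * coeff (n + 1) (A a (y - x i) *
      ∏ j ∈ Finset.univ.erase i, A (p j) (x j - x i + ind i j))) := by
    funext y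
    simp only [G, Pi.add_apply, e]
  rw [hG]
  refine h3.congr_deriv ?_
  simp only [G, e]
  rw [mul_add, Finset.mul_sum]
  congr 1
  · linear_combination (-a * coeff n (∏ j, A (p j) (x j + 1 - s))) * h
  · exact Finset.sum_congr rfl fun i _ => by ring

theorem G_zero (n : ℕ) (a : ℂ) (p x : ι → ℂ) (h : a + ∑ j, p j = -(n : ℂ)) (ha : a ≠ 1) (s : ℂ) :
    G n a p x s = 0 := by
  have hh : (a - 1) + ∑ j, p j = -((n : ℂ) + 1) := by linear_combination h
  have hd := G_deriv n (a - 1) p x hh s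
  have hc : G (n + 1) (a - 1) p x = fun _ => G (n + 1) (a - 1) p x 0 :=
    funext fun z => (G_poly _ _ p x).periodic (G_periodic n (a - 1) p x hh) z
  rw [hc] at hd
  have := hd.unique (hasDerivAt_const s _)
  rw [sub_add_cancel] at this
  exact (mul_eq_zero.1 this).resolve_left (sub_ne_zero.2 ha)

end core

theorem core2 (m n : ℕ) (p x : Fin (m + 1) → ℂ) (q : ℂ) (hq : q = -(∑ j, p j + n))
    (hp : p 0 ≠ 1) :
    q * coeff n (∏ j, A (p j) (x j)) + ∑ i, p i * coeff n (A q (1 - x i) *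
      ∏ j ∈ Finset.univ.erase i, A (p j) (x j - x i + if i < j then 1 else 0)) = 0 := by
  have h := G_zero n (p 0) (Fin.snoc (α := fun _ => ℂ) (Fin.tail p) q : Fin (m + 1) → ℂ)
    (Fin.snoc (α := fun _ => ℂ) (Fin.tail x) 0 : Fin (m + 1) → ℂ) (by
      rw [Fin.sum_univ_castSucc]
      simp only [Fin.snoc_castSucc, Fin.snoc_last, Fin.tail]
      rw [hq, Fin.sum_univ_succ]; ring) hp (x 0)
  have er : ∀ (r : ℕ) (i : Fin r) (f : Fin r → PowerSeries ℂ),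
      ∏ j ∈ Finset.univ.erase i, f j = ∏ j, if j = i then 1 else f j := by
    intro r i f
    rw [← Finset.mul_prod_erase Finset.univ _ (Finset.mem_univ i), if_pos rfl, one_mul]
    exact Finset.prod_congr rfl fun j hj => by rw [if_neg (Finset.ne_of_mem_erase hj)]
  simp only [G, er, ind] at h
  simp only [er]
  rw [Fin.prod_univ_castSucc, Fin.sum_univ_castSucc] at h
  simp only [Fin.prod_univ_castSucc (n := m), Fin.snoc_castSucc, Fin.snoc_last, Fin.tail,
    Fin.castSucc_inj, Fin.castSucc_lt_castSucc_iff, Fin.castSucc_lt_last, if_true,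
    (Fin.castSucc_lt_last _).ne, (Fin.castSucc_lt_last _).ne', if_false,
    not_lt.2 (Fin.castSucc_lt_last _).le, sub_zero, add_zero, zero_sub, mul_one] at h
  rw [Fin.sum_univ_succ]
  simp only [Fin.prod_univ_succ (n := m), Fin.succ_inj, Fin.succ_lt_succ_iff, Fin.succ_ne_zero,
    (Fin.succ_ne_zero _).symm, if_true, if_false, Fin.succ_pos, Fin.not_lt_zero, add_zero,
    one_mul]
  simp only [neg_add_eq_sub] at h
  refine Eq.trans ?_ h
  have hs : ∀ i : Fin m, p i.succ * coeff n (A q (1 - x i.succ) * (A (p 0) (x 0 - x i.succ) *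
      ∏ j : Fin m, if j = i then 1 else
        A (p j.succ) (x j.succ - x i.succ + if i < j then 1 else 0))) =
      p i.succ * coeff n (A (p 0) (x 0 - x i.succ) *
      ((∏ j : Fin m, if j = i then 1 else
        A (p j.succ) (x j.succ - x i.succ + if i < j then 1 else 0)) *
        A q (1 - x i.succ))) := by
    intro i
    congr 2
    ring
  simp only [hs]
  rw [mul_comm (A q (1 - x 0))]
  ring

theorem coeff_prod_tuple (m n : ℕ) (f : Fin m → PowerSeries ℂ) :
    coeff n (∏ j, f j) = ∑ k ∈ Finset.Nat.antidiagonalTuple m n, ∏ j, coeff (k j) (f j) := by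
  rw [coeff_prod, ← Finset.piAntidiag_univ_fin_eq_antidiagonalTuple]
  refine Finset.sum_bij (fun l _ => (l : Fin m → ℕ)) ?_ ?_ ?_ ?_
  · intro l hl
    simp only [Finset.mem_finsuppAntidiag] at hl
    simp [Finset.mem_piAntidiag, hl.1]
  · intro a _ b _ hab
    exact DFunLike.coe_injective hab
  · intro b hb
    simp only [Finset.mem_piAntidiag] at hb
    exact ⟨Finsupp.equivFunOnFinite.symm b, by simp [Finset.mem_finsuppAntidiag, hb.1], rfl⟩
  · intro l _
    rfl

theorem term_eq (p : ℂ) (hp : ∀ k : ℕ, p ≠ -(k : ℂ)) (k : ℕ) (y : ℂ) :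
    Complex.Gamma (p + k) / Complex.Gamma ((k : ℂ) + 1) * Bp k y =
      Complex.Gamma p * coeff k (A p y) := by
  have h0 : Complex.Gamma p ≠ 0 := Complex.Gamma_ne_zero hp
  simp only [S, coeff_mk]
  rw [← Complex.Gamma_add_nat_div_Gamma_eq p hp, Complex.Gamma_nat_eq_factorial]
  field_simp

end GB

/-- Theorem 3.1: gamma-function generalization of Dunne–Schubert's identity, where
`p_{m+1} = −(p_1 + ⋯ + p_m + n)`. -/
theorem gamma_bernoulli (m n : ℕ) (hm : 0 < m) (hn : 0 < n) (p : Fin m → ℂ)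
    (hp : ∀ j, ∀ z : ℤ, p j ≠ (z : ℂ))
    (hq : ∀ k : ℕ, -(∑ j, p j + n) ≠ -(k : ℂ)) (x : Fin m → ℂ) :
    Complex.Gamma (-(∑ j, p j + n) + 1) *
      ∑ k ∈ Finset.Nat.antidiagonalTuple m n,
        ∏ j, Complex.Gamma (p j + k j) / Complex.Gamma ((k j : ℂ) + 1) * Bp (k j) (x j) =
    - ∑ i, Complex.Gamma (p i + 1) *
      ∑ k ∈ Finset.Nat.antidiagonalTuple m n,
        Complex.Gamma (-(∑ j, p j + n) + k i) / Complex.Gamma ((k i : ℂ) + 1) *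
            Bp (k i) (1 - x i) *
          ∏ j ∈ Finset.univ.erase i,
            Complex.Gamma (p j + k j) / Complex.Gamma ((k j : ℂ) + 1) *
              Bp (k j) (x j - x i + if i < j then 1 else 0) := by
  obtain ⟨m, rfl⟩ : ∃ r, m = r + 1 := ⟨m - 1, by omega⟩
  have hpn : ∀ j, ∀ k : ℕ, p j ≠ -(k : ℂ) := fun j k h => hp j (-(k : ℤ)) (by rw [h]; push_cast; rfl)
  have core := GB.core2 m n p x _ rfl (fun h => hp 0 1 (by simpa using h))
  generalize -(∑ j, p j + n) = q at *
  have hq0 : q ≠ 0 := by simpa using hq 0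
  have hp0 : ∀ j, p j ≠ 0 := fun j => by simpa using hpn j 0
  have hL : ∑ k ∈ Finset.Nat.antidiagonalTuple (m + 1) n,
        ∏ j, Complex.Gamma (p j + k j) / Complex.Gamma ((k j : ℂ) + 1) * Bp (k j) (x j) =
      (∏ j, Complex.Gamma (p j)) * PowerSeries.coeff n (∏ j, GB.A (p j) (x j)) := by
    rw [GB.coeff_prod_tuple, Finset.mul_sum]
    refine Finset.sum_congr rfl fun k _ => ?_
    rw [← Finset.prod_mul_distrib]
    exact Finset.prod_congr rfl fun j _ => GB.term_eq _ (hpn j) _ _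
  have hR : ∀ i, Complex.Gamma (p i + 1) * ∑ k ∈ Finset.Nat.antidiagonalTuple (m + 1) n,
        Complex.Gamma (q + k i) / Complex.Gamma ((k i : ℂ) + 1) * Bp (k i) (1 - x i) *
          ∏ j ∈ Finset.univ.erase i,
            Complex.Gamma (p j + k j) / Complex.Gamma ((k j : ℂ) + 1) *
              Bp (k j) (x j - x i + if i < j then 1 else 0) =
      Complex.Gamma q * (∏ j, Complex.Gamma (p j)) *
        (p i * PowerSeries.coeff n (GB.A q (1 - x i) * ∏ j ∈ Finset.univ.erase i,
          GB.A (p j) (x j - x i + if i < j then 1 else 0))) := by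
    intro i
    have e : GB.A q (1 - x i) * ∏ j ∈ Finset.univ.erase i,
          GB.A (p j) (x j - x i + if i < j then 1 else 0) =
        ∏ j, if j = i then GB.A q (1 - x i) else
          GB.A (p j) (x j - x i + if i < j then 1 else 0) := by
      rw [← Finset.mul_prod_erase Finset.univ _ (Finset.mem_univ i), if_pos rfl]
      congr 1
      exact Finset.prod_congr rfl fun j hj => by rw [if_neg (Finset.ne_of_mem_erase hj)]
    rw [e, GB.coeff_prod_tuple, Complex.Gamma_add_one _ (hp0 i),
      ← Finset.mul_prod_erase Finset.univ (fun j => Complex.Gamma (p j)) (Finset.mem_univ i),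
      Finset.mul_sum, Finset.mul_sum, Finset.mul_sum]
    refine Finset.sum_congr rfl fun k _ => ?_
    rw [← Finset.mul_prod_erase Finset.univ (fun j => PowerSeries.coeff (k j) _)
      (Finset.mem_univ i), if_pos rfl, GB.term_eq q hq]
    have e2 : ∏ j ∈ Finset.univ.erase i, (Complex.Gamma (p j + k j) /
          Complex.Gamma ((k j : ℂ) + 1) * Bp (k j) (x j - x i + if i < j then 1 else 0)) =
        (∏ j ∈ Finset.univ.erase i, Complex.Gamma (p j)) * ∏ j ∈ Finset.univ.erase i,
          PowerSeries.coeff (k j) (if j = i then GB.A q (1 - x i) else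
          GB.A (p j) (x j - x i + if i < j then 1 else 0)) := by
      rw [← Finset.prod_mul_distrib]
      refine Finset.prod_congr rfl fun j hj => ?_
      rw [if_neg (Finset.ne_of_mem_erase hj)]
      exact GB.term_eq _ (hpn j) _ _
    rw [e2]
    ring
  rw [hL, Finset.sum_congr rfl fun i _ => hR i, ← Finset.mul_sum, Complex.Gamma_add_one _ hq0]
  linear_combination (Complex.Gamma q * ∏ j, Complex.Gamma (p j)) * core
end
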